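/- Let F : ℂ → ℂ⁴ be an entire holomorphic map with F(conj z) = conj(F(z)) componentwise, and let f : ℍ → ℍ be the induced slice-regular function, f(x+vy) = ρ_v(F(x+ιy)). Suppose there are n ∈ ℕ, C > 0 and R₀ > 0 such that ‖f(q)‖ ≤ C‖q‖ⁿ for all q ∈ ℍ with ‖q‖ ≥ R₀. Then f is a polynomial of degree at most n: there exist a₀, a₁, …, a_n ∈ ℍ such that f(q) = Σ_{m=0}^{n} qᵐ a_m for all q ∈ ℍ. -/

import Mathlib

noncomputable section
open Complex MeasureTheory

/-- The quaternion `i`. -/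
def qi : Quaternion ℝ := ⟨0,1,0,0⟩
/-- The quaternion `j`. -/
def qj : Quaternion ℝ := ⟨0,0,1,0⟩
/-- The quaternion `k`. -/
def qk : Quaternion ℝ := ⟨0,0,0,1⟩

/-- `ρ_v : ℂ → ℍ`, `x + ιy ↦ x + vy`. -/
def rhoC (v : Quaternion ℝ) (z : ℂ) : Quaternion ℝ := (z.re : Quaternion ℝ) + z.im • v

/-- `ρ_v : ℂ⁴ → ℍ`, `(z₀,z₁,z₂,z₃) ↦ ρ_v(z₀) + ρ_v(z₁)i + ρ_v(z₂)j + ρ_v(z₃)k`. -/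
def rho4 (v : Quaternion ℝ) (z : Fin 4 → ℂ) : Quaternion ℝ :=
  rhoC v (z 0) + rhoC v (z 1) * qi + rhoC v (z 2) * qj + rhoC v (z 3) * qk

/-- The quadratic form `Φ(z) = z₀² + z₁² + z₂² + z₃²`. -/
def Phi (z : Fin 4 → ℂ) : ℂ := z 0 ^ 2 + z 1 ^ 2 + z 2 ^ 2 + z 3 ^ 2

/-- An entire function bounded by `C‖z‖ⁿ` for large `z` is a polynomial of degree at most `n`. -/
theorem eq_sum_range_of_norm_le_mul_pow {g : ℂ → ℂ} (hg : Differentiable ℂ g) {n : ℕ} {C R₀ : ℝ}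
    (hbound : ∀ z : ℂ, R₀ ≤ ‖z‖ → ‖g z‖ ≤ C * ‖z‖ ^ n) :
    ∃ c : ℕ → ℂ, ∀ z : ℂ, g z = ∑ k ∈ Finset.range (n + 1), c k * z ^ k := by
  have hderiv : ∀ k, n < k → iteratedDeriv k g 0 = 0 := by
    intro k hk
    have hcauchy : ∀ᶠ R : ℝ in Filter.atTop,
        ‖iteratedDeriv k g 0‖ ≤ (k.factorial * C) * R ^ (-((k - n : ℕ) : ℤ)) := by
      filter_upwards [Filter.eventually_gt_atTop 0, Filter.eventually_ge_atTop R₀] with R hR hRR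
      refine (norm_iteratedDeriv_le_of_forall_mem_sphere_norm_le k hR hg.diffContOnCl
        (C := C * R ^ n) fun z hz => ?_).trans_eq ?_
      · have hz' : ‖z‖ = R := by simpa using hz
        simpa [hz'] using hbound z (hz' ▸ hRR)
      · obtain ⟨d, rfl⟩ := Nat.exists_eq_add_of_lt hk
        rw [show n + d + 1 - n = d + 1 by omega, zpow_neg, zpow_natCast]
        field_simp
        ring
    have hlim := (tendsto_zpow_atTop_zero (𝕜 := ℝ)
      (show -((k - n : ℕ) : ℤ) < 0 by omega)).const_mul (k.factorial * C)
    rw [mul_zero] at hlim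
    exact norm_le_zero_iff.mp (ge_of_tendsto hlim hcauchy)
  refine ⟨fun k => (k.factorial : ℂ)⁻¹ * iteratedDeriv k g 0, fun z => ?_⟩
  rw [← taylorSeries_eq_of_entire' 0 z hg, tsum_eq_sum (s := Finset.range (n + 1))]
  · simp
  · intro k hk
    rw [hderiv k (by simpa [Nat.lt_succ_iff] using hk)]
    simp

/-- A real entire function bounded by `C‖z‖ⁿ` for large `z` is a real polynomial of degree at most
`n`. -/
theorem eq_sum_range_ofReal_of_norm_le_mul_pow {g : ℂ → ℂ} (hg : Differentiable ℂ g)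
    (hsym : ∀ z, g ((starRingEnd ℂ) z) = (starRingEnd ℂ) (g z)) {n : ℕ} {C R₀ : ℝ}
    (hbound : ∀ z : ℂ, R₀ ≤ ‖z‖ → ‖g z‖ ≤ C * ‖z‖ ^ n) :
    ∃ c : ℕ → ℝ, ∀ z : ℂ, g z = ∑ k ∈ Finset.range (n + 1), (c k : ℂ) * z ^ k := by
  obtain ⟨c, hc⟩ := eq_sum_range_of_norm_le_mul_pow hg hbound
  refine ⟨fun k => (c k).re, fun z => ?_⟩
  have hconj : g z = ∑ k ∈ Finset.range (n + 1), (starRingEnd ℂ) (c k) * z ^ k := by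
    have h := congrArg (starRingEnd ℂ) (hc ((starRingEnd ℂ) z))
    rw [hsym, conj_conj, map_sum] at h
    simpa using h
  calc g z = (g z + g z) / 2 := by ring
    _ = _ := by
      nth_rewrite 1 [hc z]
      rw [hconj, ← Finset.sum_add_distrib, Finset.sum_div]
      refine Finset.sum_congr rfl fun k _ => ?_
      rw [re_eq_add_conj]
      ring

theorem rhoC_eq_liftAux {v : Quaternion ℝ} (hv : v ^ 2 = -1) (z : ℂ) :
    rhoC v z = Complex.liftAux v (by rw [← sq, hv]) z := by
  rw [Complex.liftAux_apply]
  rfl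

theorem rhoC_sum {v : Quaternion ℝ} (hv : v ^ 2 = -1) (s : Finset ℕ) (c : ℕ → ℝ) (z : ℂ) :
    rhoC v (∑ k ∈ s, (c k : ℂ) * z ^ k) = ∑ k ∈ s, rhoC v z ^ k * (c k : Quaternion ℝ) := by
  simp only [rhoC_eq_liftAux hv, map_sum, map_mul, map_pow]
  refine Finset.sum_congr rfl fun k _ => ?_
  rw [← rhoC_eq_liftAux hv (c k : ℂ)]
  simp [rhoC, (Quaternion.coe_commutes (c k) _)]

theorem qi_components : qi.re = 0 ∧ qi.imI = 1 ∧ qi.imJ = 0 ∧ qi.imK = 0 :=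
  ⟨rfl, rfl, rfl, rfl⟩

theorem qj_components : qj.re = 0 ∧ qj.imI = 0 ∧ qj.imJ = 1 ∧ qj.imK = 0 :=
  ⟨rfl, rfl, rfl, rfl⟩

theorem qk_components : qk.re = 0 ∧ qk.imI = 0 ∧ qk.imJ = 0 ∧ qk.imK = 1 :=
  ⟨rfl, rfl, rfl, rfl⟩

theorem norm_sq_rho4_qi_add_norm_sq_rho4_neg_qi (z : Fin 4 → ℂ) :
    ‖rho4 qi z‖ ^ 2 + ‖rho4 (-qi) z‖ ^ 2 = 2 * ∑ m, ‖z m‖ ^ 2 := by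
  simp only [sq ‖rho4 _ _‖, ← Quaternion.normSq_eq_norm_mul_self, Quaternion.normSq_def',
    Complex.sq_norm, Complex.normSq_apply, Fin.sum_univ_four]
  simp [rho4, rhoC, qi_components, qj_components, qk_components]
  ring

theorem norm_add_smul_of_eq_qi_or_neg {v : Quaternion ℝ} (hv : v = qi ∨ v = -qi) (z : ℂ) :
    ‖(z.re : Quaternion ℝ) + z.im • v‖ = ‖z‖ := by
  rw [← sq_eq_sq₀ (norm_nonneg _) (norm_nonneg _), sq, ← Quaternion.normSq_eq_norm_mul_self,
    Quaternion.normSq_def', Complex.sq_norm, Complex.normSq_apply]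
  rcases hv with rfl | rfl <;> simp [qi_components] <;> ring

/-- an entire slice-regular function `f` with `‖f(q)‖ ≤ C‖q‖ⁿ` for `‖q‖ ≥ R₀`
is a polynomial of degree at most `n`: `f(q) = Σ_{m=0}^{n} qᵐ a_m`. -/
theorem stmt_17 (F : ℂ → Fin 4 → ℂ) (hF : Differentiable ℂ F)
    (hFsym : ∀ z : ℂ, F ((starRingEnd ℂ) z) = fun m => (starRingEnd ℂ) (F z m))
    (n : ℕ) (C R₀ : ℝ) (hC : 0 < C) (hR₀ : 0 < R₀)
    (hgrowth : ∀ (x y : ℝ) (v : Quaternion ℝ), v ^ 2 = -1 →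
      R₀ ≤ ‖(x : Quaternion ℝ) + y • v‖ →
      ‖rho4 v (F (x + y * Complex.I))‖ ≤ C * ‖(x : Quaternion ℝ) + y • v‖ ^ n) :
    ∃ a : Fin (n + 1) → Quaternion ℝ,
      ∀ (x y : ℝ) (v : Quaternion ℝ), v ^ 2 = -1 →
        rho4 v (F (x + y * Complex.I)) =
          ∑ m : Fin (n + 1), ((x : Quaternion ℝ) + y • v) ^ (m : ℕ) * a m := by
  have hqi : qi ^ 2 = -1 := by ext <;> simp [sq, qi_components] <;> rfl
  have hbound : ∀ (m : Fin 4) (z : ℂ), R₀ ≤ ‖z‖ → ‖F z m‖ ≤ C * ‖z‖ ^ n := by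
    intro m z hz
    have hslice : ∀ v, v = qi ∨ v = -qi → ‖rho4 v (F z)‖ ≤ C * ‖z‖ ^ n := by
      intro v hv
      have hnorm := norm_add_smul_of_eq_qi_or_neg hv z
      have h := hgrowth z.re z.im v (by rcases hv with rfl | rfl <;> simp [hqi]) (hnorm ▸ hz)
      rwa [re_add_im, hnorm] at h
    have hpos := pow_le_pow_left₀ (norm_nonneg _) (hslice qi (.inl rfl)) 2
    have hneg := pow_le_pow_left₀ (norm_nonneg _) (hslice (-qi) (.inr rfl)) 2
    have hm := Finset.single_le_sum (f := fun m => ‖F z m‖ ^ 2) (fun _ _ => sq_nonneg _)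
      (Finset.mem_univ m)
    have hsum := norm_sq_rho4_qi_add_norm_sq_rho4_neg_qi (F z)
    refine le_of_sq_le_sq ?_ (by positivity)
    linarith
  choose c hc using fun m : Fin 4 => eq_sum_range_ofReal_of_norm_le_mul_pow
    (differentiable_pi.mp hF m) (fun z => congrFun (hFsym z) m) (hbound m)
  refine ⟨fun k => (c 0 k : Quaternion ℝ) + c 1 k * qi + c 2 k * qj + c 3 k * qk,
    fun x y v hv => ?_⟩
  have hq : rhoC v (x + y * Complex.I) = (x : Quaternion ℝ) + y • v := by simp [rhoC]
  rw [Fin.sum_univ_eq_sum_range (fun k => ((x : Quaternion ℝ) + y • v) ^ k *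
    ((c 0 k : Quaternion ℝ) + c 1 k * qi + c 2 k * qj + c 3 k * qk))]
  simp only [rho4, hc, rhoC_sum hv, hq, Finset.sum_mul, mul_add, Finset.sum_add_distrib, mul_assoc]
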